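/- arXiv:1802.04297 — 9 statements merged into one kernel-verified Lean document; each statement's English description precedes it below -/
import Mathlib

section
/- Let K ⊆ S(n) be a nonempty compact convex set and let F(X) = sup_{Y∈K} tr(YX) be its support function. Then F is uniformly elliptic, i.e. there exist constants 0 < λ ≤ Λ such that λ·tr(A) ≤ F(X+A) − F(X) ≤ Λ·tr(A) for all X ∈ S(n) and all positive semidefinite A ∈ S(n), if and only if every element of K is positive definite. -/
open Matrix

/-- The quadratic forms of a compact set of positive definite matrices are uniformly bounded
above and below by positive multiples of the squared Euclidean norm. -/
lemma IsCompact.exists_quadForm_bounds {ι : Type*} [Fintype ι] {K : Set (Matrix ι ι ℝ)}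
    (hK : IsCompact K) (hpos : ∀ Y ∈ K, Y.PosDef) :
    ∃ a b : ℝ, 0 < a ∧ a ≤ b ∧ ∀ Y ∈ K, ∀ v : ι → ℝ,
      a * (v ⬝ᵥ v) ≤ v ⬝ᵥ (Y *ᵥ v) ∧ v ⬝ᵥ (Y *ᵥ v) ≤ b * (v ⬝ᵥ v) := by
  set T : Set (Matrix ι ι ℝ × (ι → ℝ)) := K ×ˢ Metric.sphere 0 1 with hT
  have hTc : IsCompact T := hK.prod (isCompact_sphere 0 1)
  have hvv : ∀ v : ι → ℝ, v ≠ 0 → 0 < v ⬝ᵥ v := fun v hv => by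
    simpa using dotProduct_star_self_pos_iff.2 hv
  have hne : ∀ p ∈ T, p.2 ≠ 0 := by
    rintro p ⟨-, hp⟩ h
    simp [h] at hp
  set q : Matrix ι ι ℝ × (ι → ℝ) → ℝ := fun p => (p.2 ⬝ᵥ (p.1 *ᵥ p.2)) / (p.2 ⬝ᵥ p.2) with hq
  have hcont : ContinuousOn q T := by
    refine ContinuousOn.div ?_ ?_ fun p hp => (hvv _ (hne p hp)).ne'
    · exact (continuous_snd.dotProduct (continuous_fst.matrix_mulVec continuous_snd)).continuousOn
    · exact (continuous_snd.dotProduct continuous_snd).continuousOn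
  have hqpos : ∀ p ∈ T, 0 < q p := fun p hp => by
    have h := (hpos p.1 hp.1).dotProduct_mulVec_pos (hne p hp)
    exact div_pos (by simpa using h) (hvv _ (hne p hp))
  have hbounds : ∃ a b : ℝ, 0 < a ∧ a ≤ b ∧ ∀ p ∈ T, a ≤ q p ∧ q p ≤ b := by
    rcases T.eq_empty_or_nonempty with hemp | hnon
    · exact ⟨1, 1, one_pos, le_rfl, by simp [hemp]⟩
    · obtain ⟨x, hx, hmin⟩ := hTc.exists_isMinOn hnon hcont
      obtain ⟨y, hy, hmax⟩ := hTc.exists_isMaxOn hnon hcont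
      exact ⟨q x, q y, hqpos x hx, hmin hy, fun p hp => ⟨hmin hp, hmax hp⟩⟩
  obtain ⟨a, b, ha, hab, hqT⟩ := hbounds
  refine ⟨a, b, ha, hab, fun Y hY v => ?_⟩
  rcases eq_or_ne v 0 with rfl | hv
  · simp
  have hnv : ‖v‖ ≠ 0 := norm_ne_zero_iff.2 hv
  have hmem : (Y, ‖v‖⁻¹ • v) ∈ T := ⟨hY, by simp [norm_smul, hnv]⟩
  have hscale : q (Y, ‖v‖⁻¹ • v) = (v ⬝ᵥ (Y *ᵥ v)) / (v ⬝ᵥ v) := by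
    have := (hvv v hv).ne'
    simp only [hq, mulVec_smul, dotProduct_smul, smul_dotProduct, smul_eq_mul]
    field_simp
  have h := hqT _ hmem
  rw [hscale, le_div_iff₀ (hvv v hv), div_le_iff₀ (hvv v hv)] at h
  exact h

open scoped MatrixOrder Matrix.Norms.L2Operator in
/-- The trace of a product of two positive semidefinite real matrices is nonnegative. -/
lemma Matrix.PosSemidef.trace_mul_nonneg {ι : Type*} [Fintype ι] {A B : Matrix ι ι ℝ}
    (hA : A.PosSemidef) (hB : B.PosSemidef) : 0 ≤ (A * B).trace := by
  classical
  obtain ⟨C, rfl⟩ := CStarAlgebra.nonneg_iff_eq_star_mul_self.mp hB.nonneg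
  rw [star_eq_conjTranspose]
  rw [← Matrix.mul_assoc, trace_mul_comm, ← Matrix.mul_assoc]
  exact (hA.mul_mul_conjTranspose_same C).trace_nonneg

/-- **Uniform ellipticity of a sublinear operator.**
A sublinear operator `F(X) = sup_{Y ∈ K} tr (Y * X)` with convex body `K ⊆ S(n)` is
uniformly elliptic (there are `0 < λ ≤ Λ` with `λ tr A ≤ F (X + A) - F X ≤ Λ tr A` for
all symmetric `X` and positive semidefinite `A`) if and only if every element of `K`
is positive definite. -/
theorem uniformly_elliptic_iff_posDef (n : ℕ) (K : Set (Matrix (Fin n) (Fin n) ℝ))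
    (hKsymm : ∀ Y ∈ K, Y.IsSymm) (hKne : K.Nonempty) (hKcpt : IsCompact K)
    (hKconv : Convex ℝ K) (F : Matrix (Fin n) (Fin n) ℝ → ℝ)
    (hF : ∀ X, F X = sSup {r : ℝ | ∃ Y ∈ K, r = (Y * X).trace}) :
    (∃ lam Lam : ℝ, 0 < lam ∧ lam ≤ Lam ∧
      ∀ X A : Matrix (Fin n) (Fin n) ℝ, X.IsSymm → A.PosSemidef →
        lam * A.trace ≤ F (X + A) - F X ∧ F (X + A) - F X ≤ Lam * A.trace)
      ↔ ∀ Y ∈ K, Y.PosDef := by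
  have hbdd : ∀ X : Matrix (Fin n) (Fin n) ℝ,
      BddAbove {r : ℝ | ∃ Y ∈ K, r = (Y * X).trace} := fun X => by
    have hc : Continuous fun Y : Matrix (Fin n) (Fin n) ℝ => (Y * X).trace :=
      (continuous_id.matrix_mul continuous_const).matrix_trace
    refine (hKcpt.image hc).bddAbove.mono ?_
    rintro r ⟨Y, hY, rfl⟩
    exact ⟨Y, hY, rfl⟩
  have hle : ∀ X, ∀ Y ∈ K, (Y * X).trace ≤ F X := fun X Y hY => by
    rw [hF]
    exact le_csSup (hbdd X) ⟨Y, hY, rfl⟩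
  have hFle : ∀ X c, (∀ Y ∈ K, (Y * X).trace ≤ c) → F X ≤ c := fun X c h => by
    rw [hF]
    refine csSup_le (hKne.imp' (fun Y => (Y * X).trace) fun Y hY => ⟨Y, hY, rfl⟩) ?_
    rintro r ⟨Y, hY, rfl⟩
    exact h Y hY
  constructor
  · rintro ⟨lam, Lam, hlam, -, h⟩ Y hY
    refine PosDef.of_dotProduct_mulVec_pos ?_ fun v hv => ?_
    · simpa [IsHermitian, IsSymm, conjTranspose_eq_transpose_of_trivial] using hKsymm Y hY
    · have hA : (vecMulVec v v).PosSemidef := by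
        simpa using posSemidef_vecMulVec_self_star v
      have hX : (-vecMulVec v v).IsSymm := by
        simp [IsSymm, transpose_vecMulVec]
      have h1 := (h _ _ hX hA).1
      have h2 := hle (-vecMulVec v v) Y hY
      have h3 : F 0 ≤ 0 := hFle 0 0 fun Y _ => by simp
      have hvv : 0 < v ⬝ᵥ v := by simpa using dotProduct_star_self_pos_iff.2 hv
      have h4 := mul_pos hlam hvv
      simp only [neg_add_cancel, trace_vecMulVec, mul_neg, trace_neg, mul_vecMulVec] at h1 h2
      rw [star_trivial, dotProduct_comm]
      linarith
  · intro hpos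
    obtain ⟨a, b, ha, hab, hq⟩ := hKcpt.exists_quadForm_bounds hpos
    have hscalar : ∀ c : ℝ, (c • (1 : Matrix (Fin n) (Fin n) ℝ)).IsHermitian := fun c => by
      simp [IsHermitian]
    have key : ∀ A : Matrix (Fin n) (Fin n) ℝ, A.PosSemidef → ∀ Y ∈ K,
        a * A.trace ≤ (Y * A).trace ∧ (Y * A).trace ≤ b * A.trace := fun A hA Y hY => by
      have h1 : (Y - a • 1).PosSemidef :=
        PosSemidef.of_dotProduct_mulVec_nonneg ((hpos Y hY).1.sub (hscalar a)) fun v => by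
          simpa [sub_mulVec, smul_mulVec] using (hq Y hY v).1
      have h2 : (b • 1 - Y).PosSemidef :=
        PosSemidef.of_dotProduct_mulVec_nonneg ((hscalar b).sub (hpos Y hY).1) fun v => by
          simpa [sub_mulVec, smul_mulVec] using (hq Y hY v).2
      have h3 := h1.trace_mul_nonneg hA
      have h4 := h2.trace_mul_nonneg hA
      simp only [sub_mul, smul_mul, one_mul, trace_sub, trace_smul, smul_eq_mul] at h3 h4
      constructor <;> linarith
    refine ⟨a, b, ha, hab, fun X A _ hA => ⟨?_, ?_⟩⟩
    · have := hFle X (F (X + A) - a * A.trace) fun Y hY => by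
        have h1 := hle (X + A) Y hY
        rw [mul_add, trace_add] at h1
        linarith [(key A hA Y hY).1]
      linarith
    · have := hFle (X + A) (F X + b * A.trace) fun Y hY => by
        rw [mul_add, trace_add]
        linarith [(key A hA Y hY).2, hle X Y hY]
      linarith
end

section
/- Let K_F, K_G ⊆ S(n) be nonempty compact convex sets with 0 ∉ K_F and 0 ∉ K_G, and let F(X) = sup_{Y∈K_F} tr(YX), G(X) = sup_{Y∈K_G} tr(YX) be their support functions. Define the body cones C_{K_F} = {tZ | Z ∈ K_F, t ≥ 0} and C_{K_G} = {tZ | Z ∈ K_G, t ≥ 0}. Then C_{K_F} ⊆ C_{K_G} if and only if for every X ∈ S(n), G(X) ≤ 0 implies F(X) ≤ 0. -/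
open Matrix

section TraceDuality

variable {m : Type*} [Fintype m]

/-- Traces `tr (Y X)` over a compact set of matrices `Y` are bounded above. -/
lemma bddAbove_trace_mul_of_isCompact {K : Set (Matrix m m ℝ)} (hK : IsCompact K)
    (X : Matrix m m ℝ) : BddAbove {r : ℝ | ∃ Y ∈ K, r = (Y * X).trace} := by
  have hc : Continuous fun Y : Matrix m m ℝ => (Y * X).trace := by fun_prop
  have h := (hK.image hc).bddAbove
  have he : {r : ℝ | ∃ Y ∈ K, r = (Y * X).trace} = (fun Y => (Y * X).trace) '' K := by
    ext r
    simp [eq_comm]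
  rwa [he]

/-- Every linear functional on matrices agrees on symmetric matrices with the trace pairing
against some symmetric matrix. -/
lemma exists_isSymm_forall_trace_mul_eq [DecidableEq m] (f : Matrix m m ℝ →ₗ[ℝ] ℝ) :
    ∃ X : Matrix m m ℝ, X.IsSymm ∧ ∀ Y : Matrix m m ℝ, Y.IsSymm → (Y * X).trace = f Y := by
  let X₀ : Matrix m m ℝ := Matrix.of fun i j => f (Matrix.single j i 1)
  have h₀ : ∀ Y : Matrix m m ℝ, (Y * X₀).trace = f Y := by
    intro Y
    conv_rhs => rw [Matrix.matrix_eq_sum_single Y]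
    simp only [map_sum, Matrix.trace, Matrix.diag, Matrix.mul_apply, X₀, Matrix.of_apply]
    refine Finset.sum_congr rfl fun i _ => Finset.sum_congr rfl fun j _ => ?_
    rw [← smul_eq_mul, ← map_smul, Matrix.smul_single, smul_eq_mul, mul_one]
  refine ⟨(1 / 2 : ℝ) • (X₀ + X₀ᵀ), ?_, fun Y hY => ?_⟩
  · rw [Matrix.IsSymm, Matrix.transpose_smul, Matrix.transpose_add, Matrix.transpose_transpose,
      add_comm]
  · have ht : (Y * X₀ᵀ).trace = (Y * X₀).trace := by
      rw [← Matrix.trace_transpose, Matrix.transpose_mul, Matrix.transpose_transpose, hY.eq,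
        Matrix.trace_mul_comm]
    rw [Matrix.mul_smul, Matrix.trace_smul, Matrix.mul_add, Matrix.trace_add, ht, h₀, smul_eq_mul]
    ring

lemma Matrix.IsSymm.trace_mul_self_pos {Z : Matrix m m ℝ} (hZ : Z.IsSymm) (hZ0 : Z ≠ 0) :
    0 < (Z * Z).trace := by
  have h : (Zᴴ * Z).trace = (Z * Z).trace := by
    rw [Matrix.conjTranspose_eq_transpose_of_trivial, hZ.eq]
  rw [← h]
  refine lt_of_le_of_ne (Matrix.posSemidef_conjTranspose_mul_self Z).trace_nonneg fun h0 => hZ0 ?_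
  exact Matrix.trace_conjTranspose_mul_self_eq_zero_iff.1 h0.symm

/-- A compact convex set disjoint from a closed ray `{s • Z | 0 ≤ s}` is separated from it by a
functional that is bounded above by a negative constant on the set and nonnegative at `Z`. -/
lemma exists_clm_neg_on_compact_nonneg_at {E : Type*} [NormedAddCommGroup E] [NormedSpace ℝ E]
    {K : Set E} (hK : IsCompact K) (hconv : Convex ℝ K) {Z : E}
    (hdisj : ∀ s : ℝ, 0 ≤ s → s • Z ∉ K) :
    ∃ f : E →L[ℝ] ℝ, ∃ u < 0, (∀ Y ∈ K, f Y < u) ∧ 0 ≤ f Z := by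
  let L : Set E := (fun s : ℝ => s • Z) '' Set.Ici 0
  have hLconv : Convex ℝ L :=
    (convex_Ici (0 : ℝ)).is_linear_image (IsLinearMap.mk (fun a b => add_smul a b Z)
      fun a b => mul_smul a b Z)
  have hLclosed : IsClosed L := by
    exact isClosedMap_smul_left Z _ isClosed_Ici
  have hd : Disjoint K L := by
    rw [Set.disjoint_left]
    rintro _ hY ⟨s, hs, rfl⟩
    exact hdisj s hs hY
  obtain ⟨f, u, v, hu, huv, hv⟩ := geometric_hahn_banach_compact_closed hconv hK hLconv hLclosed hd
  have hv0 : v < 0 := by simpa using hv (0 • Z) ⟨0, Set.self_mem_Ici, rfl⟩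
  refine ⟨f, u, huv.trans hv0, hu, ?_⟩
  by_contra! hneg
  have h := hv ((v / f Z) • Z) ⟨v / f Z, (div_pos_of_neg_of_neg hv0 hneg).le, rfl⟩
  rw [map_smul, smul_eq_mul, div_mul_cancel₀ _ hneg.ne] at h
  exact lt_irrefl _ h

attribute [local instance] Matrix.normedAddCommGroup Matrix.normedSpace in
/-- A nonzero symmetric matrix outside the cone over a compact convex set `K` of symmetric matrices
with `0 ∉ K` is strictly separated from that cone by a symmetric matrix. -/
lemma exists_isSymm_trace_nonpos_and_pos [DecidableEq m] {K : Set (Matrix m m ℝ)}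
    (hsymm : ∀ Y ∈ K, Y.IsSymm) (hK : IsCompact K) (hconv : Convex ℝ K) (h0 : 0 ∉ K)
    {Z : Matrix m m ℝ} (hZ : Z.IsSymm) (hZ0 : Z ≠ 0)
    (hout : ¬ ∃ Y ∈ K, ∃ t : ℝ, 0 ≤ t ∧ Z = t • Y) :
    ∃ X : Matrix m m ℝ, X.IsSymm ∧ (∀ Y ∈ K, (Y * X).trace ≤ 0) ∧ 0 < (Z * X).trace := by
  have hdisj : ∀ s : ℝ, 0 ≤ s → s • Z ∉ K := by
    intro s hs hmem
    rcases hs.eq_or_lt with rfl | hs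
    · exact h0 (by simpa using hmem)
    · exact hout ⟨s • Z, hmem, s⁻¹, (inv_pos.2 hs).le, by rw [inv_smul_smul₀ hs.ne']⟩
  obtain ⟨f, u, hu, hfK, hfZ⟩ := exists_clm_neg_on_compact_nonneg_at hK hconv hdisj
  obtain ⟨X₀, hX₀, hf⟩ := exists_isSymm_forall_trace_mul_eq (f : Matrix m m ℝ →ₗ[ℝ] ℝ)
  obtain ⟨B, hB⟩ := bddAbove_trace_mul_of_isCompact hK Z
  have hpos : 0 < |B| + 1 := by positivity
  set ε : ℝ := -u / (|B| + 1) with hε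
  have hε0 : 0 < ε := div_pos (neg_pos.2 hu) hpos
  have htr : ∀ Y : Matrix m m ℝ, Y.IsSymm →
      (Y * (X₀ + ε • Z)).trace = f Y + ε * (Y * Z).trace := by
    intro Y hY
    rw [Matrix.mul_add, Matrix.trace_add, hf Y hY, Matrix.mul_smul, Matrix.trace_smul, smul_eq_mul]
    rfl
  refine ⟨X₀ + ε • Z, hX₀.add (hZ.smul ε), fun Y hY => ?_, ?_⟩
  · rw [htr Y (hsymm Y hY)]
    have hYB : (Y * Z).trace ≤ |B| + 1 := by
      linarith [hB ⟨Y, hY, rfl⟩, le_abs_self B]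
    have h1 : ε * (Y * Z).trace ≤ ε * (|B| + 1) := by gcongr
    have h2 : ε * (|B| + 1) = -u := div_mul_cancel₀ _ hpos.ne'
    linarith [hfK Y hY]
  · rw [htr Z hZ]
    have := mul_pos hε0 (hZ.trace_mul_self_pos hZ0)
    linarith

end TraceDuality

/-- **Inclusion of body cones and nesting of solution sets.**
Let `K_F, K_G ⊆ S(n)` be convex bodies not containing `0`, with support functions `F`, `G`.
Then the body cone of `K_F` is contained in the body cone of `K_G` if and only if
`G X ≤ 0` implies `F X ≤ 0` for every symmetric `X`. -/
theorem bodyCone_subset_iff (n : ℕ) (KF KG : Set (Matrix (Fin n) (Fin n) ℝ))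
    (hKFsymm : ∀ Y ∈ KF, Y.IsSymm) (hKFne : KF.Nonempty) (hKFcpt : IsCompact KF)
    (hKFconv : Convex ℝ KF) (hKF0 : (0 : Matrix (Fin n) (Fin n) ℝ) ∉ KF)
    (hKGsymm : ∀ Y ∈ KG, Y.IsSymm) (hKGne : KG.Nonempty) (hKGcpt : IsCompact KG)
    (hKGconv : Convex ℝ KG) (hKG0 : (0 : Matrix (Fin n) (Fin n) ℝ) ∉ KG)
    (F G : Matrix (Fin n) (Fin n) ℝ → ℝ)
    (hF : ∀ X, F X = sSup {r : ℝ | ∃ Y ∈ KF, r = (Y * X).trace})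
    (hG : ∀ X, G X = sSup {r : ℝ | ∃ Y ∈ KG, r = (Y * X).trace}) :
    {M : Matrix (Fin n) (Fin n) ℝ | ∃ Z ∈ KF, ∃ t : ℝ, 0 ≤ t ∧ M = t • Z}
      ⊆ {M : Matrix (Fin n) (Fin n) ℝ | ∃ Z ∈ KG, ∃ t : ℝ, 0 ≤ t ∧ M = t • Z}
    ↔ ∀ X : Matrix (Fin n) (Fin n) ℝ, X.IsSymm → G X ≤ 0 → F X ≤ 0 := by
  have hle : ∀ {K : Set (Matrix (Fin n) (Fin n) ℝ)}, IsCompact K → ∀ X, ∀ Y ∈ K,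
      (Y * X).trace ≤ sSup {r : ℝ | ∃ Y ∈ K, r = (Y * X).trace} :=
    fun hK X Y hY => le_csSup (bddAbove_trace_mul_of_isCompact hK X) ⟨Y, hY, rfl⟩
  constructor
  · intro hsub X _ hGX
    rw [hF]
    refine Real.sSup_nonpos ?_
    rintro _ ⟨Y, hY, rfl⟩
    obtain ⟨Z, hZ, t, ht, rfl⟩ := hsub ⟨Y, hY, 1, zero_le_one, (one_smul ℝ Y).symm⟩
    rw [Matrix.smul_mul, Matrix.trace_smul, smul_eq_mul]
    refine mul_nonpos_of_nonneg_of_nonpos ht ((hle hKGcpt X Z hZ).trans ?_)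
    rwa [← hG]
  · rintro hnest _ ⟨Z, hZ, t, ht, rfl⟩
    suffices h : ∃ Y ∈ KG, ∃ s : ℝ, 0 ≤ s ∧ Z = s • Y by
      obtain ⟨Y, hY, s, hs, rfl⟩ := h
      exact ⟨Y, hY, t * s, mul_nonneg ht hs, smul_smul t s Y⟩
    by_contra hout
    obtain ⟨X, hX, hXG, hXZ⟩ := exists_isSymm_trace_nonpos_and_pos hKGsymm hKGcpt hKGconv hKG0
      (hKFsymm Z hZ) (ne_of_mem_of_not_mem hZ hKF0) hout
    have hGX : G X ≤ 0 := by
      rw [hG]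
      refine Real.sSup_nonpos ?_
      rintro _ ⟨Y, hY, rfl⟩
      exact hXG Y hY
    have hFX := hnest X hX hGX
    rw [hF] at hFX
    exact absurd ((hle hKFcpt X Z hZ).trans hFX) hXZ.not_ge
end

section
/- Let K ⊆ S(n) be a nonempty compact convex set that is invariant under orthogonal conjugation, i.e. K = {QᵀYQ | Y ∈ K} for every orthogonal Q ∈ O(n). Then for every vector y ∈ ℝⁿ the following are equivalent: (1) there exists Y ∈ K whose vector of diagonal entries equals y; (2) the diagonal matrix diag(y) belongs to K. In other words, {diag Y | Y ∈ K} = {y ∈ ℝⁿ | diag(y) ∈ K}, where diag Y denotes the vector of diagonal entries of Y. -/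
open Matrix

/-- A convex set of square matrices that is closed under negating the `a`-th row and column, for
every index `a`, contains the diagonal part of each of its members. -/
theorem diagonal_diag_mem_of_convex {ι : Type*} [Fintype ι] [DecidableEq ι]
    {K : Set (Matrix ι ι ℝ)} (hK : Convex ℝ K)
    (hflip : ∀ a : ι, ∀ Y ∈ K,
      diagonal (fun i => if i = a then (-1 : ℝ) else 1) * Y *
        diagonal (fun i => if i = a then (-1 : ℝ) else 1) ∈ K)
    {Y : Matrix ι ι ℝ} (hY : Y ∈ K) : diagonal Y.diag ∈ K := by
  have clear_rows : ∀ s : Finset ι,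
      (of fun i j => if i = j ∨ (i ∉ s ∧ j ∉ s) then Y i j else 0) ∈ K := by
    intro s
    induction s using Finset.induction_on with
    | empty => simpa [-of_apply] using (show of (fun i j => Y i j) ∈ K from hY)
    | insert a s _ ih =>
      convert hK ih (hflip a _ ih) (by norm_num : (0 : ℝ) ≤ 1 / 2)
        (by norm_num : (0 : ℝ) ≤ 1 / 2) (by norm_num) using 1
      ext i j
      simp only [of_apply, Matrix.add_apply, Matrix.smul_apply, smul_eq_mul, mul_diagonal, diagonal_mul,
        Finset.mem_insert]
      grind
  convert clear_rows Finset.univ using 1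
  ext i j
  by_cases hij : i = j <;> simp [hij]

/-- **Diagonals of a symmetric convex body.**
Let `K ⊆ S(n)` be a convex body invariant under orthogonal conjugation. Then a vector
`y ∈ ℝⁿ` is the diagonal of some member of `K` iff the diagonal matrix `diag y`
belongs to `K`; i.e. `{diag Y | Y ∈ K} = {y | diagonal y ∈ K}`. -/
theorem diag_image_eq_diagonal_preimage (n : ℕ) (K : Set (Matrix (Fin n) (Fin n) ℝ))
    (hKsymm : ∀ Y ∈ K, Y.IsSymm) (hKne : K.Nonempty) (hKcpt : IsCompact K)
    (hKconv : Convex ℝ K)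
    (hKinv : ∀ Q : Matrix (Fin n) (Fin n) ℝ, Qᵀ * Q = 1 →
      K = {M : Matrix (Fin n) (Fin n) ℝ | ∃ Y ∈ K, M = Qᵀ * Y * Q}) :
    {v : Fin n → ℝ | ∃ Y ∈ K, v = Matrix.diag Y}
      = {y : Fin n → ℝ | Matrix.diagonal y ∈ K} := by
  ext y
  constructor
  · rintro ⟨Y, hY, rfl⟩
    refine diagonal_diag_mem_of_convex hKconv (fun a Z hZ => ?_) hY
    have hQ : (diagonal fun i : Fin n => if i = a then (-1 : ℝ) else 1)ᵀ *
        (diagonal fun i : Fin n => if i = a then (-1 : ℝ) else 1) = 1 := by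
      rw [diagonal_transpose, diagonal_mul_diagonal, ← diagonal_one]
      congr 1
      ext i
      split_ifs <;> norm_num
    rw [hKinv _ hQ]
    exact ⟨Z, hZ, by rw [diagonal_transpose]⟩
  · intro hy
    exact ⟨diagonal y, hy, (diag_diagonal y).symm⟩
end

section
/- Let E ∈ S(n) and let 𝓔 = {QᵀEQ | Q ∈ O(n)} be its orbit under orthogonal conjugation. Then 𝓔 equals the set of extreme points of its convex hull: extremePoints(convexHull 𝓔) = 𝓔. Similarly, for e ∈ ℝⁿ, the orbit ε = {Pe | P a permutation matrix} satisfies extremePoints(convexHull ε) = ε. -/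
open Matrix

/-- The quadratic form of a positive definite bilinear form is strictly convex. -/
theorem LinearMap.BilinForm.strictConvexOn_of_pos {V : Type*} [AddCommGroup V] [Module ℝ V]
    (B : LinearMap.BilinForm ℝ V) (hB : ∀ x, x ≠ 0 → 0 < B x x) :
    StrictConvexOn ℝ Set.univ fun x => B x x := by
  refine ⟨convex_univ, fun x _ y _ hxy a b ha hb hab => ?_⟩
  have h := mul_pos (mul_pos ha hb) (hB _ (sub_ne_zero.mpr hxy))
  obtain rfl : b = 1 - a := by linarith
  simp only [map_add, map_sub, map_smul, LinearMap.add_apply, LinearMap.sub_apply,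
    LinearMap.smul_apply, smul_eq_mul] at h ⊢
  linarith

/-- A set contained in a level set of a strictly convex function is the set of extreme points
of its convex hull. -/
theorem StrictConvexOn.extremePoints_convexHull_of_eq_const {V : Type*} [AddCommGroup V]
    [Module ℝ V] {q : V → ℝ} (hq : StrictConvexOn ℝ Set.univ q) {A : Set V} {c : ℝ}
    (hA : ∀ x ∈ A, q x = c) : Set.extremePoints ℝ (convexHull ℝ A) = A := by
  refine extremePoints_convexHull_subset.antisymm fun x hx => ?_
  have hle : ∀ y ∈ convexHull ℝ A, q y ≤ c := fun y hy =>
    (convexHull_min (t := {z ∈ Set.univ | q z ≤ c})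
      (fun z hz => ⟨Set.mem_univ z, (hA z hz).le⟩) (hq.convexOn.convex_le c) hy).2
  rw [mem_extremePoints_iff_left]
  refine ⟨subset_convexHull ℝ A hx, ?_⟩
  rintro y hy z hz ⟨a, b, ha, hb, hab, rfl⟩
  by_cases hyz : y = z
  · rw [hyz, ← add_smul, hab, one_smul]
  · have hlt := hq.2 (Set.mem_univ y) (Set.mem_univ z) hyz ha hb hab
    have hy' := mul_le_mul_of_nonneg_left (hle y hy) ha.le
    have hz' := mul_le_mul_of_nonneg_left (hle z hz) hb.le
    have hc : a * c + b * c = c := by rw [← add_mul, hab, one_mul]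
    rw [hA _ hx, smul_eq_mul, smul_eq_mul] at hlt
    linarith

/-- **Orbits are the extreme points of their convex hulls.**
For a symmetric matrix `E`, the orbit `{Qᵀ E Q | Q ∈ O(n)}` under orthogonal
conjugation is exactly the set of extreme points of its convex hull; likewise, for
`e ∈ ℝⁿ`, the orbit `{P e | P a permutation matrix}` is the set of extreme points of
its convex hull. -/
theorem orbit_extremePoints (n : ℕ) (E : Matrix (Fin n) (Fin n) ℝ) (hE : E.IsSymm)
    (e : Fin n → ℝ) :
    Set.extremePoints ℝ (convexHull ℝ
        {M : Matrix (Fin n) (Fin n) ℝ | ∃ Q : Matrix (Fin n) (Fin n) ℝ,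
          Qᵀ * Q = 1 ∧ M = Qᵀ * E * Q})
      = {M : Matrix (Fin n) (Fin n) ℝ | ∃ Q : Matrix (Fin n) (Fin n) ℝ,
          Qᵀ * Q = 1 ∧ M = Qᵀ * E * Q}
    ∧ Set.extremePoints ℝ (convexHull ℝ
        {w : Fin n → ℝ | ∃ σ : Equiv.Perm (Fin n), w = e ∘ σ})
      = {w : Fin n → ℝ | ∃ σ : Equiv.Perm (Fin n), w = e ∘ σ} := by
  constructor
  · let B : LinearMap.BilinForm ℝ (Matrix (Fin n) (Fin n) ℝ) :=
      LinearMap.mk₂ ℝ (fun M N => (Mᵀ * N).trace)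
        (by simp [add_mul]) (by simp) (by simp [mul_add]) (by simp)
    refine (B.strictConvexOn_of_pos fun M hM => ?_).extremePoints_convexHull_of_eq_const
      (c := (Eᵀ * E).trace) ?_
    · have h0 : 0 ≤ (Mᵀ * M).trace := by
        simpa using (posSemidef_conjTranspose_mul_self M).trace_nonneg
      refine h0.lt_of_ne fun h => hM ?_
      simpa using (trace_conjTranspose_mul_self_eq_zero_iff (A := M)).mp (by simpa using h.symm)
    · rintro _ ⟨Q, hQ, rfl⟩
      have hQ' : Q * Qᵀ = 1 := mul_eq_one_comm.mp hQ
      calc ((Qᵀ * E * Q)ᵀ * (Qᵀ * E * Q)).trace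
          = (Qᵀ * (Eᵀ * (Q * Qᵀ) * E * Q)).trace := by
            simp only [transpose_mul, transpose_transpose, Matrix.mul_assoc]
        _ = (Eᵀ * (Q * Qᵀ) * E * (Q * Qᵀ)).trace := by
            rw [trace_mul_comm, Matrix.mul_assoc _ Q]
        _ = (Eᵀ * E).trace := by rw [hQ', Matrix.mul_one, Matrix.mul_one]
  · let B : LinearMap.BilinForm ℝ (Fin n → ℝ) :=
      LinearMap.mk₂ ℝ (fun v w => v ⬝ᵥ w) (by simp) (by simp) (by simp) (by simp)
    refine (B.strictConvexOn_of_pos fun v hv => ?_).extremePoints_convexHull_of_eq_const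
      (c := e ⬝ᵥ e) ?_
    · have h0 : 0 ≤ v ⬝ᵥ v := Finset.sum_nonneg fun i _ => mul_self_nonneg (v i)
      exact h0.lt_of_ne fun h => hv (dotProduct_self_eq_zero.mp h.symm)
    · rintro _ ⟨σ, rfl⟩
      exact Equiv.sum_comp σ fun i => e i * e i
end

section
/- Let n ≥ 2 and let z ∈ ℝⁿ be a nonzero vector with nonnegative entries. Let M = max_i z_i, set α = (∑_i z_i)/M, and assume α ≠ 1. Define p by (α − 1)(p − 1) = n − 1, i.e. p = (n + α − 2)/(α − 1), set c = (∑_i z_i)/(n + p − 2), and let 𝐩 = (1, …, 1, p−1) ∈ ℝⁿ (first n−1 entries equal to 1, last entry p−1). Then c·𝐩 is majorized by z; equivalently, c·𝐩 lies in the convex hull of the set {Pz | P a permutation matrix} of all vectors obtained by permuting the entries of z. -/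
/-- Putting the entry `z j` at position `l` and averaging the remaining entries of `z` over the
remaining positions gives a convex combination of permutations of `z`. -/
theorem mem_convexHull_permutations_of_average {ι : Type*} [Fintype ι]
    (z y : ι → ℝ) (l j : ι) (a : ℝ) (hl : y l = z j) (hy : ∀ i, i ≠ l → y i = a)
    (hsum : ∑ i, y i = ∑ i, z i) :
    y ∈ convexHull ℝ {w : ι → ℝ | ∃ σ : Equiv.Perm ι, w = z ∘ σ} := by
  classical
  let F : Finset (Equiv.Perm ι) := {σ | σ l = j}
  have hF : F.Nonempty := ⟨Equiv.swap l j, by simp [F]⟩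
  have hF0 : (F.card : ℝ) ≠ 0 := by exact_mod_cast hF.card_pos.ne'
  let u : ι → ℝ := ∑ σ ∈ F, (F.card : ℝ)⁻¹ • (z ∘ σ)
  have hu (i : ι) : u i = (F.card : ℝ)⁻¹ * ∑ σ ∈ F, z (σ i) := by
    simp [u, Finset.sum_apply, Finset.mul_sum]
  have hmem : u ∈ convexHull ℝ {w : ι → ℝ | ∃ σ : Equiv.Perm ι, w = z ∘ σ} :=
    (convex_convexHull ℝ _).sum_mem (fun _ _ => by positivity) (by simp [hF0])
      fun σ _ => subset_convexHull ℝ _ ⟨σ, rfl⟩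
  have hul : u l = z j := by
    rw [hu, Finset.sum_congr rfl fun σ (hσ : σ ∈ F) => by
      rw [(Finset.mem_filter.1 hσ).2], Finset.sum_const, nsmul_eq_mul]
    field_simp
  have husum : ∑ i, u i = ∑ i, z i := by
    simp_rw [hu]
    rw [← Finset.mul_sum, Finset.sum_comm,
      Finset.sum_congr rfl fun σ _ => Equiv.sum_comp σ z, Finset.sum_const, nsmul_eq_mul]
    field_simp
  have husymm (i k : ι) (hi : i ≠ l) (hk : k ≠ l) : u i = u k := by
    rw [hu, hu]
    congr 1
    refine Finset.sum_equiv (Equiv.mulRight (Equiv.swap i k)) (fun σ => ?_) fun σ _ => ?_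
    · simp [F, Equiv.swap_apply_of_ne_of_ne hi.symm hk.symm]
    · simp
  suffices h : y = u from h ▸ hmem
  funext i
  by_cases hi : i = l
  · rw [hi, hl, hul]
  have hcard : (0 : ℝ) < ((Finset.univ.erase l).card : ℝ) := by
    exact_mod_cast Finset.card_pos.2 ⟨i, by simp [hi]⟩
  have hy' : ∑ k ∈ Finset.univ.erase l, y k = ((Finset.univ.erase l).card : ℝ) * y i := by
    rw [Finset.sum_congr rfl fun k hk => (hy k (Finset.ne_of_mem_erase hk)).trans (hy i hi).symm,
      Finset.sum_const, nsmul_eq_mul]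
  have hu' : ∑ k ∈ Finset.univ.erase l, u k = ((Finset.univ.erase l).card : ℝ) * u i := by
    rw [Finset.sum_congr rfl fun k hk => husymm k i (Finset.ne_of_mem_erase hk) hi,
      Finset.sum_const, nsmul_eq_mul]
  have h1 := Finset.add_sum_erase Finset.univ y (Finset.mem_univ l)
  have h2 := Finset.add_sum_erase Finset.univ u (Finset.mem_univ l)
  apply mul_left_cancel₀ hcard.ne'
  linarith


/-- **The key majorization lemma.**
Let `n ≥ 2` and let `z ∈ ℝⁿ` be nonzero with nonnegative entries, `M = max_i z_i`,
`α = (∑ z)/M ≠ 1`, `p` defined by `(α-1)(p-1) = n-1`, and `c = (∑ z)/(n+p-2)`.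
With `𝐩 = (1, …, 1, p-1)`, the vector `c • 𝐩` is majorized by `z`, i.e. `c • 𝐩` lies
in the convex hull of the permutations of `z`. -/
theorem cp_in_convexHull_of_permutations (n : ℕ) (hn : 2 ≤ n) (z : Fin n → ℝ)
    (hz : z ≠ 0) (hzpos : ∀ i, 0 ≤ z i)
    (M : ℝ) (hM : IsGreatest (Set.range z) M)
    (α p c : ℝ) (hα : α = (∑ i, z i) / M) (hα1 : α ≠ 1)
    (hp : (α - 1) * (p - 1) = (n : ℝ) - 1)
    (hc : c = (∑ i, z i) / ((n : ℝ) + p - 2))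
    (pv : Fin n → ℝ) (hpv : pv = fun i : Fin n => if (i : ℕ) = n - 1 then p - 1 else 1) :
    c • pv ∈ convexHull ℝ {w : Fin n → ℝ | ∃ σ : Equiv.Perm (Fin n), w = z ∘ σ} := by
  obtain ⟨⟨j, hj⟩, hub⟩ := hM
  have hMpos : 0 < M := by
    obtain ⟨i, hi⟩ := Function.ne_iff.1 hz
    exact ((hzpos i).lt_of_ne' hi).trans_le (hub ⟨i, rfl⟩)
  have hS : ∑ i, z i = α * M := by rw [hα]; field_simp
  have hSpos : 0 < ∑ i, z i :=
    (hj ▸ hMpos).trans_le (Finset.single_le_sum (fun i _ => hzpos i) (Finset.mem_univ j))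
  have hαpos : 0 < α := hα ▸ div_pos hSpos hMpos
  have hn1 : (0 : ℝ) < (n : ℝ) - 1 := by
    have : (2 : ℝ) ≤ n := by exact_mod_cast hn
    linarith
  have hp1 : p - 1 ≠ 0 := by
    intro h
    rw [h, mul_zero] at hp
    exact hn1.ne hp
  have hden : (n : ℝ) + p - 2 = α * (p - 1) := by linear_combination -hp
  have hcM : c * (p - 1) = M := by
    rw [hc, hden, hS]
    field_simp
  obtain ⟨m, rfl⟩ : ∃ m, n = m + 1 := ⟨n - 1, by omega⟩
  refine mem_convexHull_permutations_of_average z _ (Fin.last m) j c ?_ (fun i hi => ?_) ?_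
  · simp [hpv, hcM, hj]
  · have hi' : (i : ℕ) ≠ m := fun h => hi (Fin.ext h)
    simp [hpv, hi']
  · rw [Fin.sum_univ_castSucc]
    have hlt (i : Fin m) : (i : ℕ) ≠ m := i.isLt.ne
    simp only [hpv, Pi.smul_apply, smul_eq_mul, Fin.val_castSucc, Fin.val_last,
      Nat.add_sub_cancel, hlt, if_true, if_false, Finset.sum_const, Finset.card_univ,
      Fintype.card_fin, nsmul_eq_mul, mul_one]
    push_cast at hp
    rw [hS]
    linear_combination (-c) * hp + α * hcM
end

section
/- Let K ⊆ S(n) be a nonempty compact convex set such that 0 ∉ K, every element of K is positive semidefinite, and K is invariant under orthogonal conjugation (K = {QᵀYQ | Y ∈ K} for all Q ∈ O(n)). Let F(X) = sup_{Y∈K} tr(YX) be its support function, and for Z ∈ S(n) let λ_max(Z) = sup_{‖ξ‖=1} ξᵀZξ denote the largest eigenvalue. Define the solution cone aperture α = min_{Z∈K} tr(Z)/λ_max(Z); then α ∈ [1, n]. Assume α > 1 and set p = (n + α − 2)/(α − 1), so p ∈ [2, ∞). Then there exists a constant c > 0 such that c·(tr(X) + (p − 2)·λ_max(X)) ≤ F(X)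 for every X ∈ S(n). -/
open Matrix

/-- The largest eigenvalue of a symmetric matrix, `λ_max(Z) = sup_{‖ξ‖=1} ξᵀ Z ξ`
(the Euclidean unit sphere condition is written as `∑ ξᵢ² = 1`). -/
noncomputable def lamMax {n : ℕ} (Z : Matrix (Fin n) (Fin n) ℝ) : ℝ :=
  sSup {r : ℝ | ∃ ξ : Fin n → ℝ, (∑ i, ξ i ^ 2) = 1 ∧ r = ξ ⬝ᵥ Z.mulVec ξ}

/-- The quadratic form of `U D Uᵀ` is the weighted sum of squares of the coordinates of `Uᵀ ξ`. -/
theorem dotProduct_mulVec_conj_diagonal {n : ℕ} (U : Matrix (Fin n) (Fin n) ℝ) (d : Fin n → ℝ)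
    (ξ : Fin n → ℝ) :
    ξ ⬝ᵥ (U * diagonal d * Uᵀ).mulVec ξ = ∑ i, d i * (Uᵀ.mulVec ξ) i ^ 2 := by
  rw [← mulVec_mulVec, ← mulVec_mulVec, dotProduct_mulVec, ← mulVec_transpose]
  simp only [dotProduct, mulVec_diagonal]
  exact Finset.sum_congr rfl fun i _ => by ring

/-- Orthogonal matrices preserve the sum of squares of the coordinates. -/
theorem sum_sq_mulVec_of_orthogonal {n : ℕ} {Q : Matrix (Fin n) (Fin n) ℝ} (hQ : Qᵀ * Q = 1)
    (ξ : Fin n → ℝ) : ∑ i, (Q.mulVec ξ) i ^ 2 = ∑ i, ξ i ^ 2 := by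
  have h : Q.mulVec ξ ⬝ᵥ Q.mulVec ξ = ξ ⬝ᵥ ξ := by
    rw [dotProduct_mulVec, ← mulVec_transpose, mulVec_mulVec, hQ, one_mulVec]
  simpa only [dotProduct, sq] using h

/-- `lamMax` of an orthogonally diagonalized matrix is its largest diagonal coefficient. -/
theorem lamMax_conj_diagonal {n : ℕ} {U : Matrix (Fin n) (Fin n) ℝ} (hU : Uᵀ * U = 1)
    {d : Fin n → ℝ} {k : Fin n} (hk : ∀ i, d i ≤ d k) :
    lamMax (U * diagonal d * Uᵀ) = d k := by
  refine IsGreatest.csSup_eq ⟨⟨U.mulVec (Pi.single k 1), ?_, ?_⟩, ?_⟩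
  · rw [sum_sq_mulVec_of_orthogonal hU]
    simp [Pi.single_apply]
  · rw [dotProduct_mulVec_conj_diagonal, mulVec_mulVec, hU, one_mulVec]
    simp [Pi.single_apply]
  · rintro r ⟨ξ, hξ, rfl⟩
    have hU' : Uᵀᵀ * Uᵀ = 1 := by rw [transpose_transpose, mul_eq_one_comm.mp hU]
    rw [dotProduct_mulVec_conj_diagonal]
    calc ∑ i, d i * (Uᵀ.mulVec ξ) i ^ 2 ≤ ∑ i, d k * (Uᵀ.mulVec ξ) i ^ 2 :=
          Finset.sum_le_sum fun i _ => mul_le_mul_of_nonneg_right (hk i) (sq_nonneg _)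
      _ = d k := by rw [← Finset.mul_sum, sum_sq_mulVec_of_orthogonal hU', hξ, mul_one]

/-- The spectral theorem for real matrices, in terms of the transpose. -/
theorem Matrix.IsHermitian.exists_orthogonal_conj_diagonal {n : ℕ}
    {A : Matrix (Fin n) (Fin n) ℝ} (hA : A.IsHermitian) :
    ∃ U : Matrix (Fin n) (Fin n) ℝ, Uᵀ * U = 1 ∧ A = U * diagonal hA.eigenvalues * Uᵀ := by
  refine ⟨hA.eigenvectorUnitary, ?_, ?_⟩
  · have h := Unitary.coe_star_mul_self hA.eigenvectorUnitary
    rwa [star_eq_conjTranspose, conjTranspose_eq_transpose_of_trivial] at h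
  · have h := hA.spectral_theorem
    rw [Unitary.conjStarAlgAut_apply, star_eq_conjTranspose,
      conjTranspose_eq_transpose_of_trivial] at h
    exact h

/-- The eigenvalues of two Hermitian matrices are listed in the same order. -/
theorem Matrix.IsHermitian.monovary_eigenvalues {n : ℕ} {A B : Matrix (Fin n) (Fin n) ℝ}
    (hA : A.IsHermitian) (hB : B.IsHermitian) : Monovary hA.eigenvalues hB.eigenvalues :=
  (hA.eigenvalues₀_antitone.monovary hB.eigenvalues₀_antitone).comp_right _

/-- Some index, independent of the matrix, carries the largest eigenvalue. -/
theorem exists_forall_eigenvalues_le {n : ℕ} (hn : 0 < n) :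
    ∃ k : Fin n, ∀ (A : Matrix (Fin n) (Fin n) ℝ) (hA : A.IsHermitian) (i : Fin n),
      hA.eigenvalues i ≤ hA.eigenvalues k := by
  have hc : 0 < Fintype.card (Fin n) := by simpa using hn
  refine ⟨Fintype.equivOfCardEq (Fintype.card_fin _) ⟨0, hc⟩, fun A hA i => ?_⟩
  refine hA.eigenvalues₀_antitone ?_
  rw [Equiv.symm_apply_apply]
  exact Nat.zero_le _

/-- The trace of a product of two simultaneously diagonalized matrices. -/
theorem trace_conj_diagonal_mul {n : ℕ} {U : Matrix (Fin n) (Fin n) ℝ} (hU : Uᵀ * U = 1)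
    (d e : Fin n → ℝ) :
    ((U * diagonal d * Uᵀ) * (U * diagonal e * Uᵀ)).trace = ∑ i, d i * e i := by
  have h : (U * diagonal d * Uᵀ) * (U * diagonal e * Uᵀ)
      = U * (diagonal d * (Uᵀ * U) * diagonal e) * Uᵀ := by simp only [Matrix.mul_assoc]
  rw [h, hU, Matrix.mul_one, trace_mul_comm, ← Matrix.mul_assoc, hU, Matrix.one_mul,
    diagonal_mul_diagonal, trace_diagonal]

/-- The trace of an orthogonally diagonalized matrix. -/
theorem trace_conj_diagonal {n : ℕ} {U : Matrix (Fin n) (Fin n) ℝ} (hU : Uᵀ * U = 1)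
    (d : Fin n → ℝ) : (U * diagonal d * Uᵀ).trace = ∑ i, d i := by
  rw [trace_mul_comm, ← Matrix.mul_assoc, hU, Matrix.one_mul, trace_diagonal]

/-- **The dominative p-Laplacian is the minimal rotationally invariant sublinear
elliptic operator.** Let `K ⊆ S(n)` be a convex body of positive semidefinite matrices
with `0 ∉ K`, invariant under orthogonal conjugation, with support function `F`. Let
`α = min_{Z ∈ K} tr Z / λ_max Z` be the solution cone aperture; then `α ∈ [1, n]`.
If moreover `α > 1` and `p = (n + α - 2)/(α - 1)`, then there is `c > 0` with
`c (tr X + (p - 2) λ_max X) ≤ F X` for every symmetric `X`. -/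
theorem dominative_is_minimal (n : ℕ) (hn : 2 ≤ n) (K : Set (Matrix (Fin n) (Fin n) ℝ))
    (hKsymm : ∀ Y ∈ K, Y.IsSymm) (hKne : K.Nonempty) (hKcpt : IsCompact K)
    (hKconv : Convex ℝ K) (hK0 : (0 : Matrix (Fin n) (Fin n) ℝ) ∉ K)
    (hKpsd : ∀ Y ∈ K, Y.PosSemidef)
    (hKinv : ∀ Q : Matrix (Fin n) (Fin n) ℝ, Qᵀ * Q = 1 →
      K = {M : Matrix (Fin n) (Fin n) ℝ | ∃ Y ∈ K, M = Qᵀ * Y * Q})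
    (F : Matrix (Fin n) (Fin n) ℝ → ℝ)
    (hF : ∀ X, F X = sSup {r : ℝ | ∃ Y ∈ K, r = (Y * X).trace})
    (α : ℝ) (hα : IsLeast {r : ℝ | ∃ Z ∈ K, r = Z.trace / lamMax Z} α)
    (hα1 : 1 < α) (p : ℝ) (hp : p = ((n : ℝ) + α - 2) / (α - 1)) :
    (1 ≤ α ∧ α ≤ (n : ℝ)) ∧
    ∃ c : ℝ, 0 < c ∧ ∀ X : Matrix (Fin n) (Fin n) ℝ, X.IsSymm →
      c * (X.trace + (p - 2) * lamMax X) ≤ F X := by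
  obtain ⟨⟨Z, hZK, hZα⟩, -⟩ := hα
  obtain ⟨k, hk⟩ := exists_forall_eigenvalues_le (n := n) (by lia)
  have hZ := (hKpsd Z hZK).isHermitian
  obtain ⟨V, hV, hZV⟩ := hZ.exists_orthogonal_conj_diagonal
  have hz0 := (hKpsd Z hZK).eigenvalues_nonneg
  have hzk := hk Z hZ
  have hmono := fun (X : Matrix (Fin n) (Fin n) ℝ) (hX : X.IsHermitian) =>
    hZ.monovary_eigenvalues hX
  generalize hZ.eigenvalues = z at hZV hz0 hzk hmono
  have hlam : lamMax Z = z k := by rw [hZV, lamMax_conj_diagonal hV hzk]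
  have htr : Z.trace = ∑ i, z i := by rw [hZV, trace_conj_diagonal hV]
  rw [hlam, htr] at hZα
  have hzpos : 0 < z k := by
    refine (hz0 k).lt_of_ne fun h => ?_
    rw [← h, div_zero] at hZα
    linarith
  have hsum : ∑ i, z i = α * z k := by rw [hZα, div_mul_cancel₀ _ hzpos.ne']
  refine ⟨⟨hα1.le, ?_⟩, ?_⟩
  · rw [hZα, div_le_iff₀ hzpos]
    simpa using Finset.sum_le_card_nsmul Finset.univ z (z k) fun i _ => hzk i
  have hN : 0 < (n : ℝ) - 1 := by
    have : (2 : ℝ) ≤ n := by exact_mod_cast hn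
    linarith
  have hα' : 0 < α - 1 := by linarith
  refine ⟨(α - 1) * z k / ((n : ℝ) - 1), by positivity, fun X hX => ?_⟩
  have hX' : X.IsHermitian := by rwa [IsHermitian, conjTranspose_eq_transpose_of_trivial]
  obtain ⟨U, hU, hXU⟩ := hX'.exists_orthogonal_conj_diagonal
  have hxk := hk X hX'
  have hmono := hmono X hX'
  generalize hX'.eigenvalues = x at hXU hxk hmono
  have hlamX : lamMax X = x k := by rw [hXU, lamMax_conj_diagonal hU hxk]
  have htrX : X.trace = ∑ i, x i := by rw [hXU, trace_conj_diagonal hU]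
  have hYK : U * diagonal z * Uᵀ ∈ K := by
    rw [hKinv (V * Uᵀ) (by
      rw [transpose_mul, transpose_transpose, Matrix.mul_assoc, ← Matrix.mul_assoc Vᵀ, hV,
        Matrix.one_mul, mul_eq_one_comm.mp hU])]
    refine ⟨Z, hZK, ?_⟩
    have h : (V * Uᵀ)ᵀ * Z * (V * Uᵀ) = U * ((Vᵀ * V) * diagonal z * (Vᵀ * V)) * Uᵀ := by
      rw [hZV, transpose_mul, transpose_transpose]
      simp only [Matrix.mul_assoc]
    rw [h, hV, Matrix.one_mul, Matrix.mul_one]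
  have hFle : ∑ i, z i * x i ≤ F X := by
    rw [hF X]
    refine le_csSup ?_ ⟨_, hYK, by rw [hXU, trace_conj_diagonal_mul hU]⟩
    have hcont : Continuous fun Y : Matrix (Fin n) (Fin n) ℝ => (Y * X).trace := by fun_prop
    refine (hKcpt.image hcont).bddAbove.mono ?_
    rintro r ⟨Y, hY, rfl⟩
    exact ⟨Y, hY, rfl⟩
  refine le_trans ?_ hFle
  have hcheb := (hmono.monovaryOn ↑(Finset.univ.erase k)).sum_mul_sum_le_card_mul_sum
  rw [Finset.card_erase_of_mem (Finset.mem_univ k), Finset.card_univ, Fintype.card_fin,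
    Nat.cast_sub (by lia), Nat.cast_one] at hcheb
  have hz := Finset.add_sum_erase Finset.univ z (Finset.mem_univ k)
  have hx := Finset.add_sum_erase Finset.univ x (Finset.mem_univ k)
  have hzx := Finset.add_sum_erase Finset.univ (fun i => z i * x i) (Finset.mem_univ k)
  have hzs : ∑ i ∈ Finset.univ.erase k, z i = (α - 1) * z k := by linarith
  rw [hzs] at hcheb
  rw [htrX, hlamX, ← hzx, ← hx, hp]
  generalize ∑ i ∈ Finset.univ.erase k, x i = s at hcheb
  have hrw : (α - 1) * z k / ((n : ℝ) - 1) * (x k + s + ((n + α - 2) / (α - 1) - 2) * x k)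
      = z k * x k + (α - 1) * z k * s / ((n : ℝ) - 1) := by
    field_simp
    ring
  rw [hrw]
  gcongr
  rw [div_le_iff₀ hN]
  linarith
end

section
/- Let K ⊆ S(n) be a nonempty compact convex set such that 0 ∉ K, every element of K is positive semidefinite, and K is invariant under orthogonal conjugation (K = {QᵀYQ | Y ∈ K} for all Q ∈ O(n)). Let α = min_{Z∈K} tr(Z)/λ_max(Z) be the solution cone aperture, where λ_max(Z) = sup_{‖ξ‖=1} ξᵀZξ. Let Λ_α ∈ S(n) be the diagonal matrix whose first n−1 diagonal entries equal −1 and whose last diagonal entry equals α−1. Then sup_{Y∈K} tr(Y·Λ_α) = 0. -/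
open Matrix

/-- The quadratic form of a matrix attains its supremum over the Euclidean unit sphere. -/
theorem isGreatest_lamMax {n : ℕ} (hn : 0 < n) (Z : Matrix (Fin n) (Fin n) ℝ) :
    IsGreatest {r : ℝ | ∃ ξ : Fin n → ℝ, (∑ i, ξ i ^ 2) = 1 ∧ r = ξ ⬝ᵥ Z.mulVec ξ}
      (lamMax Z) := by
  have hS : IsCompact {ξ : Fin n → ℝ | (∑ i, ξ i ^ 2) = 1} := by
    refine (isCompact_univ_pi
      (fun _ : Fin n => isCompact_Icc (a := (-1 : ℝ)) (b := 1))).of_isClosed_subset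
      (isClosed_eq (by fun_prop) continuous_const) ?_
    intro ξ hξ i _
    have h : ξ i ^ 2 ≤ ∑ j, ξ j ^ 2 :=
      Finset.single_le_sum (f := fun j => ξ j ^ 2) (fun j _ => sq_nonneg _) (Finset.mem_univ i)
    rw [show ∑ j, ξ j ^ 2 = 1 from hξ] at h
    exact abs_le.mp ((sq_le_one_iff_abs_le_one _).mp h)
  have himage : {r : ℝ | ∃ ξ : Fin n → ℝ, (∑ i, ξ i ^ 2) = 1 ∧ r = ξ ⬝ᵥ Z.mulVec ξ} =
      (fun ξ : Fin n → ℝ => ξ ⬝ᵥ Z.mulVec ξ) '' {ξ | (∑ i, ξ i ^ 2) = 1} := by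
    ext r
    simp [eq_comm]
  have hcont : Continuous (fun ξ : Fin n → ℝ => ξ ⬝ᵥ Z.mulVec ξ) :=
    continuous_id.dotProduct (continuous_const.matrix_mulVec continuous_id)
  have hne : {ξ : Fin n → ℝ | (∑ i, ξ i ^ 2) = 1}.Nonempty :=
    ⟨Pi.single ⟨0, hn⟩ 1, by simp [Pi.single_apply]⟩
  unfold lamMax
  rw [himage]
  exact (hS.image hcont).isGreatest_sSup (hne.image _)

theorem diag_le_lamMax {n : ℕ} (Z : Matrix (Fin n) (Fin n) ℝ) (i : Fin n) :
    Z i i ≤ lamMax Z :=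
  (isGreatest_lamMax i.pos Z).2
    ⟨Pi.single i 1, by simp [Pi.single_apply], by simp⟩

theorem lamMax_pos {n : ℕ} {Z : Matrix (Fin n) (Fin n) ℝ} (hZ : Z.PosSemidef) (h0 : Z ≠ 0) :
    0 < lamMax Z := by
  have htr : 0 < Z.trace :=
    lt_of_le_of_ne hZ.trace_nonneg fun h => h0 (hZ.trace_eq_zero_iff.mp h.symm)
  obtain ⟨i, -, hi⟩ := Finset.exists_lt_of_sum_lt (s := Finset.univ) (f := fun _ : Fin n => (0 : ℝ))
    (g := fun i => Z i i) (by simpa [Matrix.trace] using htr)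
  exact hi.trans_le (diag_le_lamMax Z i)

/-- Every Euclidean unit vector is the `k`-th column of an orthogonal matrix. -/
theorem exists_orthogonal_col_eq {n : ℕ} (k : Fin n) (ξ : Fin n → ℝ) (hξ : (∑ i, ξ i ^ 2) = 1) :
    ∃ Q : Matrix (Fin n) (Fin n) ℝ, Qᵀ * Q = 1 ∧ ∀ i, Q i k = ξ i := by
  have hnorm : ‖WithLp.toLp 2 ξ‖ = 1 := by
    simp [EuclideanSpace.norm_eq, hξ]
  have horth : Orthonormal ℝ
      (({k} : Set (Fin n)).domRestrict fun _ => (WithLp.toLp 2 ξ : EuclideanSpace ℝ (Fin n))) :=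
    ⟨fun _ => hnorm, fun i j hij => (hij (Subsingleton.elim i j)).elim⟩
  obtain ⟨b, hb⟩ := horth.exists_orthonormalBasis_extension_of_card_eq (by simp)
  refine ⟨Matrix.of fun i j => b j i, ?_, fun i => ?_⟩
  · ext i j
    have h := orthonormal_iff_ite.mp b.orthonormal i j
    simpa [Matrix.mul_apply, Matrix.one_apply, PiLp.inner_apply, mul_comm] using h
  · simp [hb k rfl]

theorem trace_mul_diagonal_ite {n : ℕ} (Y : Matrix (Fin n) (Fin n) ℝ) (α : ℝ) (k : Fin n)
    (hk : (k : ℕ) = n - 1) :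
    (Y * Matrix.diagonal (fun i : Fin n =>
      if (i : ℕ) = n - 1 then α - 1 else -1)).trace = α * Y k k - Y.trace := by
  have h : ∀ i : Fin n, Y i i * (if (i : ℕ) = n - 1 then α - 1 else -1) =
      (if i = k then α * Y i i else 0) - Y i i := by
    intro i
    simp only [← hk, ← Fin.ext_iff]
    split_ifs <;> ring
  simp [Matrix.trace, Matrix.mul_diagonal, h, Finset.sum_sub_distrib]

/-- **Existence of fundamental solutions: `F(Λ_α) = 0`.**
Let `K ⊆ S(n)` be a convex body of positive semidefinite matrices with `0 ∉ K`,
invariant under orthogonal conjugation, and let `α = min_{Z ∈ K} tr Z / λ_max Z` be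
its solution cone aperture. With `Λ_α = diag(-1, …, -1, α-1)`, the support function
of `K` vanishes at `Λ_α`: `sup_{Y ∈ K} tr (Y Λ_α) = 0`. -/
theorem support_function_vanishes_at_Lambda_alpha (n : ℕ) (hn : 2 ≤ n)
    (K : Set (Matrix (Fin n) (Fin n) ℝ))
    (hKsymm : ∀ Y ∈ K, Y.IsSymm) (hKne : K.Nonempty) (hKcpt : IsCompact K)
    (hKconv : Convex ℝ K) (hK0 : (0 : Matrix (Fin n) (Fin n) ℝ) ∉ K)
    (hKpsd : ∀ Y ∈ K, Y.PosSemidef)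
    (hKinv : ∀ Q : Matrix (Fin n) (Fin n) ℝ, Qᵀ * Q = 1 →
      K = {M : Matrix (Fin n) (Fin n) ℝ | ∃ Y ∈ K, M = Qᵀ * Y * Q})
    (α : ℝ) (hα : IsLeast {r : ℝ | ∃ Z ∈ K, r = Z.trace / lamMax Z} α) :
    sSup {r : ℝ | ∃ Y ∈ K,
        r = (Y * Matrix.diagonal (fun i : Fin n =>
              if (i : ℕ) = n - 1 then α - 1 else -1)).trace} = 0 := by
  set k : Fin n := ⟨n - 1, by omega⟩
  have hpos : ∀ Y ∈ K, 0 < lamMax Y := fun Y hY =>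
    lamMax_pos (hKpsd Y hY) fun h => hK0 (h ▸ hY)
  obtain ⟨⟨Z, hZ, hαZ⟩, hmin⟩ := hα
  have hα0 : 0 ≤ α := hαZ ▸ div_nonneg (hKpsd Z hZ).trace_nonneg (hpos Z hZ).le
  refine IsGreatest.csSup_eq ⟨?_, ?_⟩
  · obtain ⟨ξ, hξ, hmax⟩ := (isGreatest_lamMax k.pos Z).1
    obtain ⟨Q, hQ, hcol⟩ := exists_orthogonal_col_eq k ξ hξ
    have hmem : Qᵀ * Z * Q ∈ K := by
      rw [hKinv Q hQ]
      exact ⟨Z, hZ, rfl⟩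
    have htr : (Qᵀ * Z * Q).trace = Z.trace := by
      rw [Matrix.trace_mul_comm, ← Matrix.mul_assoc, mul_eq_one_comm.mp hQ, Matrix.one_mul]
    have hkk : (Qᵀ * Z * Q) k k = lamMax Z := by
      rw [hmax, Matrix.mul_assoc]
      simp [Matrix.mul_apply, Matrix.mulVec, dotProduct, hcol]
    refine ⟨_, hmem, ?_⟩
    rw [trace_mul_diagonal_ite _ α k rfl, htr, hkk, hαZ, div_mul_cancel₀ _ (hpos Z hZ).ne',
      sub_self]
  · rintro r ⟨Y, hY, rfl⟩
    rw [trace_mul_diagonal_ite Y α k rfl, sub_nonpos]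
    exact (mul_le_mul_of_nonneg_left (diag_le_lamMax Y k) hα0).trans
      ((le_div_iff₀ (hpos Y hY)).mp (hmin ⟨Y, hY, rfl⟩))
end

section
/- (von Neumann's trace inequality for symmetric matrices) Let A, B ∈ S(n) with eigenvalues λ₁(A) ≤ ⋯ ≤ λₙ(A) and λ₁(B) ≤ ⋯ ≤ λₙ(B), each listed in increasing order with multiplicity. Then tr(AB) ≤ ∑_{i=1}^{n} λ_i(A)·λ_i(B). -/
open Matrix

/-- The rearrangement inequality with a doubly stochastic matrix in place of a permutation. -/
theorem Monovary.dotProduct_mulVec_le_of_mem_doublyStochastic {ι : Type*} [Fintype ι]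
    [DecidableEq ι] {f g : ι → ℝ} (hfg : Monovary f g) {M : Matrix ι ι ℝ}
    (hM : M ∈ doublyStochastic ℝ ι) : f ⬝ᵥ M *ᵥ g ≤ f ⬝ᵥ g := by
  have h_convex : Convex ℝ {N : Matrix ι ι ℝ | f ⬝ᵥ N *ᵥ g ≤ f ⬝ᵥ g} :=
    convex_halfSpace_le (f := fun N : Matrix ι ι ℝ => f ⬝ᵥ N *ᵥ g)
      ⟨fun N P => by simp only [add_mulVec, dotProduct_add],
        fun c N => by simp only [smul_mulVec, dotProduct_smul]⟩ _
  have h_mem : M ∈ (doublyStochastic ℝ ι : Set (Matrix ι ι ℝ)) := hM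
  rw [doublyStochastic_eq_convexHull_permMatrix] at h_mem
  refine convexHull_min ?_ h_convex h_mem
  rintro _ ⟨σ, rfl⟩
  simpa [permMatrix_mulVec, dotProduct] using hfg.sum_mul_comp_perm_le_sum_mul (σ := σ)

/-- The entrywise square of an orthogonal matrix is doubly stochastic. -/
theorem Matrix.hadamard_self_mem_doublyStochastic {ι : Type*} [Fintype ι] [DecidableEq ι]
    {U : Matrix ι ι ℝ} (hU : Uᵀ * U = 1) : U ⊙ U ∈ doublyStochastic ℝ ι := by
  refine mem_doublyStochastic_iff_sum.2 ⟨fun i j => mul_self_nonneg _, fun i => ?_, fun j => ?_⟩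
  · have hU' : U * Uᵀ = 1 := mul_eq_one_comm.1 hU
    simpa [mul_apply] using congrFun (congrFun hU' i) i
  · simpa [mul_apply] using congrFun (congrFun hU j) j

theorem Matrix.trace_diagonal_mul_mul_diagonal_mul_transpose {ι : Type*} [Fintype ι]
    [DecidableEq ι] (f g : ι → ℝ) (U : Matrix ι ι ℝ) :
    (diagonal f * U * diagonal g * Uᵀ).trace = f ⬝ᵥ (U ⊙ U) *ᵥ g := by
  simp only [trace, diag_apply, mul_apply (N := Uᵀ), mul_diagonal, diagonal_mul, transpose_apply,
    dotProduct, mulVec, hadamard_apply, Finset.mul_sum]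
  exact Finset.sum_congr rfl fun i _ => Finset.sum_congr rfl fun j _ => by ring

/-- **von Neumann's trace inequality for symmetric matrices.**
If `A`, `B` are symmetric `n × n` real matrices whose eigenvalues, listed in increasing
order with multiplicity, are `μ` and `ν` (i.e. `A = Qᵀ (diag μ) Q`, `B = Rᵀ (diag ν) R`
with `Q`, `R` orthogonal and `μ`, `ν` monotone), then `tr (A B) ≤ ∑ i, μ i * ν i`. -/
theorem vonNeumann_trace_inequality (n : ℕ) (A B : Matrix (Fin n) (Fin n) ℝ)
    (μ ν : Fin n → ℝ) (hμ : Monotone μ) (hν : Monotone ν)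
    (hA : ∃ Q : Matrix (Fin n) (Fin n) ℝ, Qᵀ * Q = 1 ∧ A = Qᵀ * Matrix.diagonal μ * Q)
    (hB : ∃ R : Matrix (Fin n) (Fin n) ℝ, Rᵀ * R = 1 ∧ B = Rᵀ * Matrix.diagonal ν * R) :
    (A * B).trace ≤ ∑ i, μ i * ν i := by
  obtain ⟨Q, hQ, rfl⟩ := hA
  obtain ⟨R, hR, rfl⟩ := hB
  have hU : (Q * Rᵀ)ᵀ * (Q * Rᵀ) = 1 := by
    rw [transpose_mul, transpose_transpose, Matrix.mul_assoc, ← Matrix.mul_assoc Qᵀ, hQ,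
      Matrix.one_mul, mul_eq_one_comm.1 hR]
  have h_trace : (Qᵀ * diagonal μ * Q * (Rᵀ * diagonal ν * R)).trace =
      (diagonal μ * (Q * Rᵀ) * diagonal ν * (Q * Rᵀ)ᵀ).trace := by
    rw [transpose_mul, transpose_transpose, Matrix.mul_assoc Qᵀ, Matrix.mul_assoc Qᵀ,
      trace_mul_comm]
    simp only [Matrix.mul_assoc]
  rw [h_trace, trace_diagonal_mul_mul_diagonal_mul_transpose]
  exact (hμ.monovary hν).dotProduct_mulVec_le_of_mem_doublyStochastic
    (hadamard_self_mem_doublyStochastic hU)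
end

section
/- Let A ∈ S(n). Then for every X ∈ S(n), sup_{Q∈O(n)} tr(QᵀAQ·X) = ∑_{i=1}^{n} λ_i(A)·λ_i(X), where λ₁(A) ≤ ⋯ ≤ λₙ(A) and λ₁(X) ≤ ⋯ ≤ λₙ(X) are the eigenvalues of A and X listed in increasing order with multiplicity; in particular this supremum is attained, and the function X ↦ ∑_i λ_i(A)·λ_i(X) is the support function of the convex hull of the orbit {QᵀAQ | Q ∈ O(n)} and is therefore sublinear. -/
open Matrix

/-- The entrywise square of an orthogonal matrix is doubly stochastic. -/
theorem sq_mem_doublyStochastic_of_orthogonal {ι : Type*} [Fintype ι] [DecidableEq ι]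
    {Q : Matrix ι ι ℝ} (hQ : Qᵀ * Q = 1) :
    (Matrix.of fun i j => Q i j ^ 2) ∈ doublyStochastic ℝ ι := by
  rw [mem_doublyStochastic_iff_sum]
  have hQ' : Q * Qᵀ = 1 := mul_eq_one_comm.mp hQ
  refine ⟨fun i j => sq_nonneg _, fun i => ?_, fun j => ?_⟩
  · simpa [Matrix.mul_apply, sq] using congrFun (congrFun hQ' i) i
  · simpa [Matrix.mul_apply, sq] using congrFun (congrFun hQ j) j

/-- A doubly stochastic matrix cannot pair two monovarying vectors to more than their
inner product. -/
theorem sum_mul_mul_le_of_mem_doublyStochastic {ι : Type*} [Fintype ι] [DecidableEq ι]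
    {μ ν : ι → ℝ} (h : Monovary μ ν) {M : Matrix ι ι ℝ} (hM : M ∈ doublyStochastic ℝ ι) :
    ∑ i, ∑ j, μ i * M i j * ν j ≤ ∑ i, μ i * ν i := by
  rw [← SetLike.mem_coe, doublyStochastic_eq_convexHull_permMatrix] at hM
  have hconv : Convex ℝ {M : Matrix ι ι ℝ | ∑ i, ∑ j, μ i * M i j * ν j ≤ ∑ i, μ i * ν i} := by
    refine convex_halfSpace_le (𝕜 := ℝ) ⟨fun M N => ?_, fun c M => ?_⟩ _
    · simp only [Matrix.add_apply, mul_add, add_mul, Finset.sum_add_distrib]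
    · simp only [Matrix.smul_apply, smul_eq_mul, Finset.mul_sum]
      exact Finset.sum_congr rfl fun i _ => Finset.sum_congr rfl fun j _ => by ring
  refine convexHull_min ?_ hconv hM
  rintro _ ⟨σ, rfl⟩
  simpa [Equiv.Perm.permMatrix, PEquiv.toMatrix_apply] using h.sum_mul_comp_perm_le_sum_mul (σ := σ)

theorem trace_conj_diagonal_mul_diagonal {ι : Type*} [Fintype ι] [DecidableEq ι]
    (Q : Matrix ι ι ℝ) (μ ν : ι → ℝ) :
    (Qᵀ * Matrix.diagonal μ * Q * Matrix.diagonal ν).trace =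
      ∑ i, ∑ j, μ i * Q i j ^ 2 * ν j := by
  rw [Finset.sum_comm]
  simp only [Matrix.trace, Matrix.diag_apply, Matrix.mul_apply,
    Matrix.transpose_apply, Matrix.diagonal_apply, mul_ite, mul_zero, Finset.sum_ite_eq',
    Finset.mem_univ, if_true, Finset.sum_mul]
  exact Finset.sum_congr rfl fun i _ => Finset.sum_congr rfl fun j _ => by ring

/-- **Von Neumann's trace inequality** on an orthogonal orbit, with the equality case. -/
theorem isGreatest_trace_orthogonal_orbit {ι : Type*} [Fintype ι] [DecidableEq ι]
    {P R : Matrix ι ι ℝ} {μ ν : ι → ℝ} (h : Monovary μ ν) (hP : Pᵀ * P = 1)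
    (hR : Rᵀ * R = 1) :
    IsGreatest {r : ℝ | ∃ Q : Matrix ι ι ℝ, Qᵀ * Q = 1 ∧
      r = ((Qᵀ * (Pᵀ * Matrix.diagonal μ * P) * Q) * (Rᵀ * Matrix.diagonal ν * R)).trace}
      (∑ i, μ i * ν i) := by
  have hP' := mul_eq_one_comm.mp hP
  have hR' := mul_eq_one_comm.mp hR
  constructor
  · refine ⟨Pᵀ * R, ?_, ?_⟩
    · rw [transpose_mul, transpose_transpose, Matrix.mul_assoc, ← Matrix.mul_assoc P, hP',
        Matrix.one_mul, hR]
    · have hconj : (Pᵀ * R)ᵀ * (Pᵀ * Matrix.diagonal μ * P) * (Pᵀ * R) *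
          (Rᵀ * Matrix.diagonal ν * R) =
          Rᵀ * (P * Pᵀ) * Matrix.diagonal μ * (P * Pᵀ) * (R * Rᵀ) * Matrix.diagonal ν * R := by
        simp only [transpose_mul, transpose_transpose, Matrix.mul_assoc]
      rw [hconj, hP', hR', Matrix.mul_one, Matrix.mul_one, Matrix.mul_one, trace_mul_comm,
        Matrix.mul_assoc, ← Matrix.mul_assoc, hR', Matrix.one_mul, diagonal_mul_diagonal,
        trace_diagonal]
  · rintro _ ⟨Q, hQ, rfl⟩
    have hU : (P * Q * Rᵀ)ᵀ * (P * Q * Rᵀ) = 1 := by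
      have hassoc : (P * Q * Rᵀ)ᵀ * (P * Q * Rᵀ) = R * (Qᵀ * (Pᵀ * P) * Q) * Rᵀ := by
        simp only [transpose_mul, transpose_transpose, Matrix.mul_assoc]
      rw [hassoc, hP, Matrix.mul_one, hQ, Matrix.mul_one, hR']
    have htrace : (Qᵀ * (Pᵀ * Matrix.diagonal μ * P) * Q * (Rᵀ * Matrix.diagonal ν * R)).trace =
        ((P * Q * Rᵀ)ᵀ * Matrix.diagonal μ * (P * Q * Rᵀ) * Matrix.diagonal ν).trace := by
      rw [← Matrix.mul_assoc _ _ R, trace_mul_comm _ R]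
      simp only [transpose_mul, transpose_transpose, Matrix.mul_assoc]
    rw [htrace, trace_conj_diagonal_mul_diagonal]
    exact sum_mul_mul_le_of_mem_doublyStochastic h (sq_mem_doublyStochastic_of_orthogonal hU)

/-- An upper bound for `Y ↦ tr (Y X)` on a set is one on its convex hull. -/
theorem trace_mul_le_of_mem_convexHull {ι : Type*} [Fintype ι] {S : Set (Matrix ι ι ℝ)}
    {X : Matrix ι ι ℝ} {c : ℝ} (h : ∀ Y ∈ S, (Y * X).trace ≤ c) {Y : Matrix ι ι ℝ}
    (hY : Y ∈ convexHull ℝ S) : (Y * X).trace ≤ c := by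
  have hconv : Convex ℝ {Y : Matrix ι ι ℝ | (Y * X).trace ≤ c} :=
    convex_halfSpace_le (𝕜 := ℝ)
      ⟨fun M N => by rw [Matrix.add_mul, trace_add], fun t M => by rw [Matrix.smul_mul, trace_smul]⟩ _
  exact convexHull_min h hconv hY

theorem abs_apply_le_one_of_orthogonal {ι : Type*} [Fintype ι] [DecidableEq ι]
    {Q : Matrix ι ι ℝ} (hQ : Qᵀ * Q = 1) (i j : ι) : |Q i j| ≤ 1 := by
  have hsum := sum_col_of_mem_doublyStochastic (sq_mem_doublyStochastic_of_orthogonal hQ) j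
  rw [← sq_le_one_iff_abs_le_one, ← hsum]
  exact Finset.single_le_sum (f := fun k => Q k j ^ 2) (fun k _ => sq_nonneg _)
    (Finset.mem_univ i)

/-- The linear functional `Y ↦ tr (Y X)` is bounded above on the convex hull of an orthogonal
orbit. -/
theorem bddAbove_trace_convexHull_orthogonal_orbit {ι : Type*} [Fintype ι] [DecidableEq ι]
    (A X : Matrix ι ι ℝ) :
    BddAbove {r : ℝ | ∃ Y ∈ convexHull ℝ {M : Matrix ι ι ℝ | ∃ Q : Matrix ι ι ℝ,
      Qᵀ * Q = 1 ∧ M = Qᵀ * A * Q}, r = (Y * X).trace} := by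
  refine ⟨∑ i, ∑ j, ∑ k, ∑ l, |A l k| * |X j i|, ?_⟩
  rintro _ ⟨Y, hY, rfl⟩
  refine trace_mul_le_of_mem_convexHull ?_ hY
  rintro _ ⟨Q, hQ, rfl⟩
  simp only [Matrix.trace, Matrix.diag_apply, Matrix.mul_apply, Matrix.transpose_apply,
    Finset.sum_mul]
  refine Finset.sum_le_sum fun i _ => Finset.sum_le_sum fun j _ => Finset.sum_le_sum fun k _ =>
    Finset.sum_le_sum fun l _ => ?_
  calc Q l i * A l k * Q k j * X j i
      ≤ |Q l i * A l k * Q k j * X j i| := le_abs_self _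
    _ = |Q l i| * |Q k j| * (|A l k| * |X j i|) := by simp only [abs_mul]; ring
    _ ≤ |A l k| * |X j i| := mul_le_of_le_one_left (by positivity)
        (mul_le_one₀ (abs_apply_le_one_of_orthogonal hQ l i) (abs_nonneg _)
          (abs_apply_le_one_of_orthogonal hQ k j))

/-- **Singleton-generated sublinear operators.**
Let `A` be symmetric with increasing eigenvalue list `μ` (i.e. `A = Qᵀ (diag μ) Q`,
`Q` orthogonal, `μ` monotone), and let `F` be the support function of the convex hull
of the orbit `{Qᵀ A Q | Q ∈ O(n)}`. Then for every symmetric `X` with increasing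
eigenvalue list `ν`, `sup_{Q ∈ O(n)} tr (Qᵀ A Q X) = ∑ i, μ i * ν i`, the supremum
being attained, and `F X = ∑ i, μ i * ν i`; moreover `F` is sublinear (subadditive and
positively homogeneous) on the symmetric matrices. -/
theorem singleton_generated_operator (n : ℕ) (A : Matrix (Fin n) (Fin n) ℝ)
    (μ : Fin n → ℝ) (hμ : Monotone μ)
    (hA : ∃ Q : Matrix (Fin n) (Fin n) ℝ, Qᵀ * Q = 1 ∧ A = Qᵀ * Matrix.diagonal μ * Q)
    (F : Matrix (Fin n) (Fin n) ℝ → ℝ)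
    (hF : ∀ X, F X = sSup {r : ℝ | ∃ Y ∈ convexHull ℝ
        {M : Matrix (Fin n) (Fin n) ℝ | ∃ Q : Matrix (Fin n) (Fin n) ℝ,
          Qᵀ * Q = 1 ∧ M = Qᵀ * A * Q}, r = (Y * X).trace}) :
    (∀ (X : Matrix (Fin n) (Fin n) ℝ) (ν : Fin n → ℝ), Monotone ν →
      (∃ R : Matrix (Fin n) (Fin n) ℝ, Rᵀ * R = 1 ∧ X = Rᵀ * Matrix.diagonal ν * R) →
      IsGreatest {r : ℝ | ∃ Q : Matrix (Fin n) (Fin n) ℝ,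
          Qᵀ * Q = 1 ∧ r = ((Qᵀ * A * Q) * X).trace} (∑ i, μ i * ν i)
      ∧ F X = ∑ i, μ i * ν i)
    ∧ (∀ X Y : Matrix (Fin n) (Fin n) ℝ, X.IsSymm → Y.IsSymm →
        F (X + Y) ≤ F X + F Y)
    ∧ (∀ (t : ℝ) (X : Matrix (Fin n) (Fin n) ℝ), 0 ≤ t → X.IsSymm →
        F (t • X) = t * F X) := by
  have hmem : A ∈ convexHull ℝ {M : Matrix (Fin n) (Fin n) ℝ |
      ∃ Q : Matrix (Fin n) (Fin n) ℝ, Qᵀ * Q = 1 ∧ M = Qᵀ * A * Q} :=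
    subset_convexHull _ _ ⟨1, by simp, by simp⟩
  refine ⟨?_, ?_, ?_⟩
  · rintro X ν hν ⟨R, hR, rfl⟩
    obtain ⟨P, hP, rfl⟩ := hA
    have hgreatest := isGreatest_trace_orthogonal_orbit (hμ.monovary hν) hP hR
    refine ⟨hgreatest, ?_⟩
    rw [hF]
    refine IsGreatest.csSup_eq ⟨?_, ?_⟩
    · obtain ⟨Q, hQ, hr⟩ := hgreatest.1
      exact ⟨_, subset_convexHull _ _ ⟨Q, hQ, rfl⟩, hr⟩
    · rintro _ ⟨Y, hY, rfl⟩
      refine trace_mul_le_of_mem_convexHull ?_ hY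
      rintro _ ⟨Q, hQ, rfl⟩
      exact hgreatest.2 ⟨Q, hQ, rfl⟩
  · intro X Y _ _
    simp only [hF]
    refine csSup_le ⟨_, A, hmem, rfl⟩ ?_
    rintro _ ⟨Z, hZ, rfl⟩
    rw [Matrix.mul_add, trace_add]
    exact add_le_add
      (le_csSup (bddAbove_trace_convexHull_orthogonal_orbit A X) ⟨Z, hZ, rfl⟩)
      (le_csSup (bddAbove_trace_convexHull_orthogonal_orbit A Y) ⟨Z, hZ, rfl⟩)
  · intro t X ht _
    rw [hF, hF, ← smul_eq_mul, ← Real.sSup_smul_of_nonneg ht]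
    congr 1
    ext r
    simp only [Set.mem_smul_set, Set.mem_ofPred_eq]
    constructor
    · rintro ⟨Y, hY, rfl⟩
      exact ⟨_, ⟨Y, hY, rfl⟩, by rw [Matrix.mul_smul, trace_smul]⟩
    · rintro ⟨_, ⟨Y, hY, rfl⟩, rfl⟩
      exact ⟨Y, hY, by rw [Matrix.mul_smul, trace_smul]⟩
end
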